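/- Let m > n ≥ 1 with m = k₀n + s₁, 0 < s₁ < n, and let F_l be the weighted Fibonacci sequence attached to the continued fraction data of (m,n). For the self-injective Nakayama algebra A_{n,m}, if l is odd with l < d+1, then every indecomposable module of length t with s_{l+1} ≤ t ≤ s_l (and t ≤ m/2) has rigidity degree exactly 2F_l. -/

import Mathlib

open CategoryTheory CategoryTheory.Limits Opposite

universe u

namespace Rigidity

variable (Λ : Type u) [Ring Λ]

/-- `X` belongs to `add M`: it is a direct summand of a finite direct sum of copies of `M`. -/
def InAdd (M X : ModuleCat.{u} Λ) : Prop :=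
  ∃ (r : ℕ) (Y : ModuleCat.{u} Λ), Nonempty ((X ⊞ Y) ≅ ⨁ (fun _ : Fin r => M))

/-- An indecomposable object. -/
def Indec (X : ModuleCat.{u} Λ) : Prop :=
  ¬ IsZero X ∧ ∀ A B : ModuleCat.{u} Λ, Nonempty (X ≅ A ⊞ B) → IsZero A ∨ IsZero B

/-- A generator-cogenerator: `add M` contains the regular module and all
finitely generated injective modules. -/
def IsGenCogen (M : ModuleCat.{u} Λ) : Prop :=
  InAdd Λ M (ModuleCat.of Λ Λ) ∧
  ∀ I : ModuleCat.{u} Λ, Module.Finite Λ I → Injective I → InAdd Λ M I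

/-- `g : A ⟶ X` is a right minimal `add M`-approximation. -/
def IsRMApprox (M : ModuleCat.{u} Λ) {A X : ModuleCat.{u} Λ} (g : A ⟶ X) : Prop :=
  InAdd Λ M A ∧
  (∀ T : ModuleCat.{u} Λ, InAdd Λ M T → ∀ f : T ⟶ X, ∃ h : T ⟶ A, h ≫ g = f) ∧
  (∀ h : A ⟶ A, h ≫ g = g → IsIso h)

/-- `IsMSyzygy M X r W` : `W` is an `r`-th `M`-syzygy `Ω_M^r(X)` of `X`. -/
inductive IsMSyzygy (M : ModuleCat.{u} Λ) : ModuleCat.{u} Λ → ℕ → ModuleCat.{u} Λ → Prop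
  | zero (X : ModuleCat.{u} Λ) : IsMSyzygy M X 0 X
  | succ (X : ModuleCat.{u} Λ) (r : ℕ) (W A : ModuleCat.{u} Λ) (g : A ⟶ W)
      (hW : IsMSyzygy M X r W) (hg : IsRMApprox Λ M g) :
      IsMSyzygy M X (r + 1) (kernel g)

/-- The `M`-dimension of `X` is at most `r`. -/
def MdimLE (M X : ModuleCat.{u} Λ) (r : ℕ) : Prop :=
  ∃ W : ModuleCat.{u} Λ, IsMSyzygy Λ M X r W ∧ InAdd Λ M W

/-- projective dimension at most `r`, via a length `r` projective resolution. -/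
def ProjDimLE (A : Type u) [Ring A] (N : ModuleCat.{u} A) (r : ℕ) : Prop :=
  ∃ (P : ℕ → ModuleCat.{u} A) (d : ∀ i : ℕ, P (i + 1) ⟶ P i) (f : P 0 ⟶ N),
    (∀ i, Projective (P i)) ∧ (∀ i, r < i → IsZero (P i)) ∧ Epi f ∧
    (∃ w : d 0 ≫ f = 0, (ShortComplex.mk (d 0) f w).Exact) ∧
    (∀ i, ∃ w : d (i + 1) ≫ d i = 0, (ShortComplex.mk (d (i + 1)) (d i) w).Exact)

/-- global dimension at most `r`. -/
def GldimLE (A : Type u) [Ring A] (r : ℕ) : Prop :=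
  ∀ N : ModuleCat.{u} A, ProjDimLE A N r

/-- the global dimension, as an element of `ℕ∞`. -/
noncomputable def gldim (A : Type u) [Ring A] : ℕ∞ :=
  sInf {c : ℕ∞ | ∃ r : ℕ, c = (r : ℕ∞) ∧ GldimLE A r}

/-- dominant dimension at least `r`: there is an exact sequence
`0 → A → I^0 → ⋯ → I^(r-1)` with all `I^i` projective-injective. -/
def DomdimGE (A : Type u) [Ring A] (r : ℕ) : Prop :=
  ∃ (I : ℕ → ModuleCat.{u} A) (f : ModuleCat.of A A ⟶ I 0) (g : ∀ i : ℕ, I i ⟶ I (i + 1)),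
    Mono f ∧ (∀ i, i < r → Injective (I i) ∧ Projective (I i)) ∧
    (2 ≤ r → ∃ w : f ≫ g 0 = 0, (ShortComplex.mk f (g 0) w).Exact) ∧
    (∀ i, i + 3 ≤ r → ∃ w : g i ≫ g (i + 1) = 0, (ShortComplex.mk (g i) (g (i + 1)) w).Exact)

/-- the dominant dimension, as an element of `ℕ∞`. -/
noncomputable def domdim (A : Type u) [Ring A] : ℕ∞ :=
  sSup {c : ℕ∞ | ∃ r : ℕ, c = (r : ℕ∞) ∧ DomdimGE A r}

/-- the rigidity degree of a module, as an element of `ℕ∞`. -/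
noncomputable def rigDeg [HasExt.{u} (ModuleCat.{u} Λ)] (M : ModuleCat.{u} Λ) : ℕ∞ :=
  sSup {c : ℕ∞ | ∃ r : ℕ, c = (r : ℕ∞) ∧ 0 < r ∧
    ∀ i : ℕ, 1 ≤ i → i ≤ r → Subsingleton (Abelian.Ext M M i)}

/-- the rigidity dimension. -/
noncomputable def rigdim : ℕ∞ :=
  sSup {c : ℕ∞ | ∃ M : ModuleCat.{u} Λ, Module.Finite Λ M ∧ IsGenCogen Λ M ∧
    (∃ r : ℕ, GldimLE (End (op M)) r) ∧ c = domdim (End (op M))}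

/-- An Auslander-Reiten (almost split) sequence. -/
def IsARSeq {X Y Z : ModuleCat.{u} Λ} (f : X ⟶ Y) (g : Y ⟶ Z) : Prop :=
  Mono f ∧ Epi g ∧ (∃ w : f ≫ g = 0, (ShortComplex.mk f g w).Exact) ∧
  Indec Λ X ∧ Indec Λ Z ∧
  (¬ ∃ s : Z ⟶ Y, s ≫ g = 𝟙 Z) ∧
  (∀ (W : ModuleCat.{u} Λ) (h : W ⟶ Z), (¬ ∃ s : Z ⟶ W, s ≫ h = 𝟙 Z) →
    ∃ h' : W ⟶ Y, h' ≫ g = h)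

/-- `X` has composition length `t`. -/
def HasCompLength (X : ModuleCat.{u} Λ) (t : ℕ) : Prop :=
  (∃ c : Fin (t + 1) → Submodule Λ X, StrictMono c ∧ c 0 = ⊥ ∧ c (Fin.last t) = ⊤) ∧
  ∀ r : ℕ, (∃ c : Fin (r + 1) → Submodule Λ X, StrictMono c ∧ c 0 = ⊥ ∧ c (Fin.last r) = ⊤) →
    r ≤ t


/-- powers of the Jacobson radical, as left submodules of `Λ`. -/
def radPow (Λ : Type u) [Ring Λ] : ℕ → Submodule Λ Λ
  | 0 => ⊤
  | r + 1 => Submodule.span Λ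
      {x : Λ | ∃ a ∈ Ideal.jacobson (⊥ : Ideal Λ), ∃ b ∈ radPow Λ r, x = a * b}

/-- `Λ` is the connected self-injective Nakayama algebra over `k`
with `n` simple modules and Loewy length `m`. -/
structure IsSelfInjNakayama (k : Type u) (Λ : Type u) [Field k] [Ring Λ] [Algebra k Λ]
    (n m : ℕ) : Prop where
  findim : FiniteDimensional k Λ
  connected : ∀ e : Λ, IsIdempotentElem e → e ∈ Set.center Λ → e = 0 ∨ e = 1
  selfinj : Injective (ModuleCat.of Λ Λ)
  uniserial : ∀ X : ModuleCat.{u} Λ, Module.Finite Λ X → Indec Λ X →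
    ∀ N₁ N₂ : Submodule Λ X, N₁ ≤ N₂ ∨ N₂ ≤ N₁
  simples : ∃ S : Fin n → ModuleCat.{u} Λ, (∀ i, IsSimpleModule Λ (S i)) ∧
    (∀ i j, Nonempty (S i ≅ S j) → i = j) ∧
    ∀ T : ModuleCat.{u} Λ, IsSimpleModule Λ T → ∃ i, Nonempty (T ≅ S i)
  loewy_top : radPow Λ m = ⊥
  loewy_bot : radPow Λ (m - 1) ≠ ⊥

section Residues

theorem convergent_relations {n d : ℕ} {s F : ℕ → ℕ} (hs0 : s 0 = n)
    (hrec : ∀ i, i ≤ d → s (i + 2) = s i % s (i + 1))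
    (hF0 : F 0 = 1) (hF1 : F 1 = s 0 / s 1)
    (hFrec : ∀ j, j + 2 ≤ d + 1 → F (j + 2) = (s (j + 1) / s (j + 2)) * F (j + 1) + F j)
    (j : ℕ) (hj : j ≤ d) :
    ∃ g g' : ℤ, F j * s 1 - n * g = (-1) ^ j * s (j + 1) ∧
      F (j + 1) * s 1 - n * g' = (-1) ^ (j + 1) * s (j + 2) ∧
      F j * g' - F (j + 1) * g = (-1) ^ j := by
  induction j with
  | zero =>
    have h : (s 1 * (s 0 / s 1) + s 2 : ℕ) = s 0 := by
      rw [hrec 0 hj]; exact Nat.div_add_mod _ _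
    zify at h
    refine ⟨0, 1, by simp [hF0], ?_, by simp [hF0]⟩
    rw [hF1, ← hs0]
    push_cast
    linear_combination h
  | succ j ih =>
    obtain ⟨g, g', h1, h2, h3⟩ := ih (by omega)
    have h : (s (j + 2) * (s (j + 1) / s (j + 2)) + s (j + 3) : ℕ) = s (j + 1) := by
      rw [hrec (j + 1) hj]; exact Nat.div_add_mod _ _
    have hF := hFrec j (by omega)
    set k := s (j + 1) / s (j + 2)
    zify at h hF
    refine ⟨g', k * g' + g, h2, ?_, ?_⟩
    · rw [hF]
      linear_combination k * h2 + h1 - (-1) ^ j * h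
    · rw [hF]
      linear_combination -h3

theorem pos_of_weighted_fibonacci {d : ℕ} {s F : ℕ → ℕ} (hs : s 1 ≤ s 0)
    (hpos : ∀ i, i ≤ d + 1 → 0 < s i) (hF0 : F 0 = 1) (hF1 : F 1 = s 0 / s 1)
    (hFrec : ∀ j, j + 2 ≤ d + 1 → F (j + 2) = (s (j + 1) / s (j + 2)) * F (j + 1) + F j)
    (j : ℕ) (hj : j ≤ d) : 0 < F j ∧ 0 < F (j + 1) := by
  induction j with
  | zero =>
    rw [hF0, hF1]
    exact ⟨one_pos, Nat.div_pos hs (hpos 1 (by omega))⟩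
  | succ j ih =>
    obtain ⟨h1, h2⟩ := ih (by omega)
    refine ⟨h2, ?_⟩
    rw [hFrec j (by omega)]
    omega

/-- Lattice form of the best approximation property of consecutive convergents. -/
theorem convergent_separation {a b A B g g' s n i y : ℤ} (ha : 0 < a) (hb : 0 < b) (hA : 0 < A)
    (hB : 0 < B) (h1 : a * s - n * g = A) (h2 : b * s - n * g' = -B) (h3 : a * g' - b * g = 1) :
    (1 ≤ i → i ≤ b → i * s - n * y < 0 ∨ A ≤ i * s - n * y) ∧
    (0 ≤ i → i < b → 0 ≤ i * s - n * y ∨ i * s - n * y < -A) := by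
  obtain ⟨p, q, hi, hv⟩ : ∃ p q : ℤ, i = p * a + q * b ∧ i * s - n * y = p * A - q * B := by
    refine ⟨i * g' - b * y, a * y - g * i, ?_, ?_⟩
    · linear_combination -i * h3
    · linear_combination -(i * s - n * y) * h3 + (i * g' - b * y) * h1 + (a * y - g * i) * h2
  rw [hv]
  refine ⟨fun l1 l2 => ?_, fun l1 l2 => ?_⟩
  · rcases le_or_gt q 0 with hq | hq
    · have : 0 < p := by
        by_contra! hp
        nlinarith
      right; nlinarith
    · have : p ≤ 0 := by
        by_contra! hp
        nlinarith
      left; nlinarith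
  · rcases le_or_gt q 0 with hq | hq
    · have : 0 ≤ p := by
        by_contra! hp
        nlinarith
      left; nlinarith
    · have : p < 0 := by
        by_contra! hp
        nlinarith
      right; nlinarith

theorem residues_of_odd_convergent {n m d : ℕ} {s F : ℕ → ℕ} (hs0 : s 0 = n) (hs1 : s 1 = m % n)
    (hrec : ∀ i, i ≤ d → s (i + 2) = s i % s (i + 1)) (hpos : ∀ i, i ≤ d + 1 → 0 < s i)
    (hF0 : F 0 = 1) (hF1 : F 1 = s 0 / s 1)
    (hFrec : ∀ j, j + 2 ≤ d + 1 → F (j + 2) = (s (j + 1) / s (j + 2)) * F (j + 1) + F j)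
    {l t : ℕ} (hlodd : Odd l) (hl : l < d + 1) (htlo : s (l + 1) ≤ t) (hthi : t ≤ s l) :
    0 < F l ∧ (∃ c < t, F l * m + t ≡ c [MOD n]) ∧
      (∀ i, 1 ≤ i → i ≤ F l → ¬ ∃ c < t, i * m ≡ c [MOD n]) ∧
      (∀ i < F l, ¬ ∃ c < t, i * m + t ≡ c [MOD n]) := by
  obtain ⟨r, rfl⟩ := hlodd
  obtain ⟨g, g', h1, h2, h3⟩ :=
    convergent_relations hs0 hrec hF0 hF1 hFrec (2 * r) (by omega)
  have hn : 0 < n := hs0 ▸ hpos 0 (by omega)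
  obtain ⟨ha, hb⟩ := pos_of_weighted_fibonacci (by
    rw [hs0, hs1]; exact (Nat.mod_lt _ hn).le) hpos hF0 hF1 hFrec (2 * r) (by omega)
  have hA := hpos (2 * r + 1) (by omega)
  have hB := hpos (2 * r + 2) (by omega)
  have e1 : (-1 : ℤ) ^ (2 * r) = 1 := by simp
  have e2 : (-1 : ℤ) ^ (2 * r + 1) = -1 := by simp [pow_succ]
  rw [e1, one_mul] at h1
  rw [e2, neg_one_mul] at h2
  rw [e1] at h3
  obtain ⟨q, hm⟩ : ∃ q : ℤ, n * q + s 1 = m :=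
    ⟨(m / n : ℕ), by rw [hs1]; exact_mod_cast Nat.div_add_mod m n⟩
  replace htlo : s (2 * r + 2) ≤ t := htlo
  have sep := fun i y : ℤ => convergent_separation (i := i) (y := y) (by exact_mod_cast ha)
    (by exact_mod_cast hb) (by exact_mod_cast hA) (by exact_mod_cast hB) h1 h2 h3
  refine ⟨hb, ⟨t - s (2 * r + 2), by omega, ?_⟩, ?_, ?_⟩
  · refine (Nat.modEq_iff_dvd.2 ⟨-(F (2 * r + 1) * q + g'), ?_⟩)
    rw [Nat.cast_sub htlo]
    push_cast
    linear_combination -h2 + F (2 * r + 1) * hm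
  · rintro i hi1 hi2 ⟨c, hc, hmod⟩
    obtain ⟨y, hy⟩ := Nat.modEq_iff_dvd.1 hmod
    push_cast at hy
    have e : (i : ℤ) * s 1 - n * (-y - i * q) = c := by
      linear_combination i * hm - hy
    have := (sep i (-y - i * q)).1 (by exact_mod_cast hi1) (by exact_mod_cast hi2)
    omega
  · rintro i hi ⟨c, hc, hmod⟩
    obtain ⟨y, hy⟩ := Nat.modEq_iff_dvd.1 hmod
    push_cast at hy
    have e : (i : ℤ) * s 1 - n * (-y - i * q) = c - t := by
      linear_combination i * hm - hy
    have := (sep i (-y - i * q)).2 (by positivity) (by exact_mod_cast hi)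
    omega

end Residues

section DimensionShift

variable {C : Type*} [Category C] [Abelian C] [HasExt.{u} C] {S : ShortComplex C}

theorem subsingleton_ext_succ_iff (hS : S.ShortExact) [Projective S.X₂] (Y : C) (j : ℕ) :
    Subsingleton (Abelian.Ext.{u} S.X₃ Y (j + 2)) ↔
      Subsingleton (Abelian.Ext.{u} S.X₁ Y (j + 1)) := by
  constructor
  · intro h
    refine subsingleton_of_forall_eq 0 fun x => ?_
    obtain ⟨x₂, rfl⟩ := Abelian.Ext.contravariant_sequence_exact₁ hS Y x (add_comm _ _)
      (Subsingleton.elim (h := h) _ 0)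
    rw [Abelian.Ext.eq_zero_of_projective x₂]
    simp
  · intro h
    refine subsingleton_of_forall_eq 0 fun x => ?_
    obtain ⟨x₁, rfl⟩ := Abelian.Ext.contravariant_sequence_exact₃ hS Y x
      (Abelian.Ext.eq_zero_of_projective _) (n₀ := j + 1) (by omega)
    rw [Subsingleton.elim (h := h) x₁ 0]
    simp

theorem subsingleton_ext_one_iff (hS : S.ShortExact) [Projective S.X₂] (Y : C) :
    Subsingleton (Abelian.Ext.{u} S.X₃ Y 1) ↔
      ∀ f : S.X₁ ⟶ Y, ∃ g : S.X₂ ⟶ Y, S.f ≫ g = f := by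
  constructor
  · intro h f
    obtain ⟨x₂, hx⟩ := Abelian.Ext.contravariant_sequence_exact₁ hS Y (Abelian.Ext.mk₀ f)
      (n₁ := 1) rfl (Subsingleton.elim (h := h) _ 0)
    obtain ⟨g, rfl⟩ := Abelian.Ext.homEquiv₀.symm.surjective x₂
    refine ⟨g, ?_⟩
    exact Abelian.Ext.homEquiv₀.symm.injective
      (by simpa [Abelian.Ext.homEquiv₀] using hx)
  · intro h
    refine subsingleton_of_forall_eq 0 fun x => ?_
    obtain ⟨x₁, rfl⟩ := Abelian.Ext.contravariant_sequence_exact₃ hS Y x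
      (Abelian.Ext.eq_zero_of_projective (n := 0) _) (n₀ := 0) rfl
    obtain ⟨f, rfl⟩ := Abelian.Ext.homEquiv₀.symm.surjective x₁
    obtain ⟨g, rfl⟩ := h f
    simp [Abelian.Ext.homEquiv₀, ← Abelian.Ext.mk₀_comp_mk₀]

end DimensionShift

section KernelShift

variable {Λ}

theorem kernel_shortExact {P M : ModuleCat.{u} Λ} (f : P →ₗ[Λ] M) (hf : Function.Surjective f) :
    (ShortComplex.mk (ModuleCat.ofHom (LinearMap.ker f).subtype) (ModuleCat.ofHom f)
      (by ext x; simp)).ShortExact where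
  exact := by
    rw [ShortComplex.ShortExact.moduleCat_exact_iff_function_exact]
    exact LinearMap.exact_subtype_ker_map f
  mono_f := (ModuleCat.mono_iff_injective _).2 (Submodule.subtype_injective _)
  epi_g := (ModuleCat.epi_iff_surjective _).2 hf

variable [HasExt.{u} (ModuleCat.{u} Λ)]

theorem subsingleton_ext_ker_iff {P M : ModuleCat.{u} Λ} [Module.Projective Λ P]
    (f : P →ₗ[Λ] M) (hf : Function.Surjective f) (Y : ModuleCat.{u} Λ) (j : ℕ) :
    Subsingleton (Abelian.Ext.{u} M Y (j + 2)) ↔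
      Subsingleton (Abelian.Ext.{u} (ModuleCat.of Λ (LinearMap.ker f)) Y (j + 1)) :=
  have : Projective P := (IsProjective.iff_projective P).1 inferInstance
  subsingleton_ext_succ_iff (kernel_shortExact f hf) Y j

theorem subsingleton_ext_one_iff_ker {P M : ModuleCat.{u} Λ} [Module.Projective Λ P]
    (f : P →ₗ[Λ] M) (hf : Function.Surjective f) (Y : ModuleCat.{u} Λ)
    (hY : ∀ g : P →ₗ[Λ] Y, LinearMap.ker f ≤ LinearMap.ker g) :
    Subsingleton (Abelian.Ext.{u} M Y 1) ↔ ∀ h : LinearMap.ker f →ₗ[Λ] Y, h = 0 := by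
  have : Projective P := (IsProjective.iff_projective P).1 inferInstance
  refine (subsingleton_ext_one_iff (kernel_shortExact f hf) Y).trans ⟨fun H h => ?_, fun H h => ?_⟩
  · obtain ⟨g, hg⟩ := H (ModuleCat.ofHom h)
    ext x
    have := congr($hg x)
    simp only [ModuleCat.hom_comp, ModuleCat.hom_ofHom, LinearMap.comp_apply] at this
    exact this.symm.trans (hY g.hom x.2)
  · refine ⟨0, ?_⟩
    ext x
    have := congr($(H h.hom) x)
    simpa using this.symm

end KernelShift

section Uniserial

variable {Λ} {M N : Type*} [AddCommGroup M] [Module Λ M]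
  [AddCommGroup N] [Module Λ N]

/-- The submodules of `M` form a chain. -/
def IsUniserial (Λ M : Type*) [Ring Λ] [AddCommGroup M] [Module Λ M] : Prop :=
  ∀ N₁ N₂ : Submodule Λ M, N₁ ≤ N₂ ∨ N₂ ≤ N₁

theorem IsUniserial.submodule (h : IsUniserial Λ M) (K : Submodule Λ M) : IsUniserial Λ K :=
  fun N₁ N₂ => by
    simpa [Submodule.map_le_map_iff_of_injective K.subtype_injective] using
      h (N₁.map K.subtype) (N₂.map K.subtype)

theorem IsUniserial.of_surjective (h : IsUniserial Λ M) (f : M →ₗ[Λ] N)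
    (hf : Function.Surjective f) : IsUniserial Λ N :=
  fun N₁ N₂ => by
    simpa [Submodule.comap_le_comap_iff_of_surjective hf] using
      h (N₁.comap f) (N₂.comap f)

theorem IsUniserial.coatom_unique (h : IsUniserial Λ M) {K L : Submodule Λ M} (hK : IsCoatom K)
    (hL : IsCoatom L) : K = L := by
  rcases h K L with h | h
  · exact ((hK.le_iff.1 h).resolve_left hL.1).symm
  · exact (hL.le_iff.1 h).resolve_left hK.1

theorem IsUniserial.surjective_of_not_le (h : IsUniserial Λ M) {K : Submodule Λ M}
    (hK : IsCoatom K) {f : N →ₗ[Λ] M} (hf : ¬ LinearMap.range f ≤ K) : Function.Surjective f :=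
  LinearMap.range_eq_top.1 (hK.2 _ (lt_of_le_not_ge ((h _ _).resolve_left hf) hf))

theorem length_ker_add_length_range (f : M →ₗ[Λ] N) :
    Module.length Λ (LinearMap.ker f) + Module.length Λ (LinearMap.range f) =
      Module.length Λ M :=
  (Module.length_eq_add_of_exact (LinearMap.ker f).subtype f.rangeRestrict
    (Submodule.subtype_injective _) f.surjective_rangeRestrict (by
      rw [LinearMap.exact_iff]; simp)).symm

theorem length_ker_add_length_of_surjective (f : M →ₗ[Λ] N) (hf : Function.Surjective f) :
    Module.length Λ (LinearMap.ker f) + Module.length Λ N = Module.length Λ M :=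
  (Module.length_eq_add_of_exact (LinearMap.ker f).subtype f
    (Submodule.subtype_injective _) hf (LinearMap.exact_subtype_ker_map f)).symm

theorem length_eq_of_covBy {K L : Submodule Λ M} (h : K ⋖ L) :
    Module.length Λ L = Module.length Λ K + 1 := by
  have : IsSimpleModule Λ (L ⧸ K.submoduleOf L) := (covBy_iff_quot_is_simple h.le).1 h
  rw [← length_ker_add_length_of_surjective _ (Submodule.mkQ_surjective (K.submoduleOf L)),
    Submodule.ker_mkQ, Module.length_eq_one Λ (L ⧸ K.submoduleOf L),
    (Submodule.submoduleOfEquivOfLe h.le).length_eq]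

theorem length_eq_of_isCoatom {K : Submodule Λ M} (h : IsCoatom K) :
    Module.length Λ M = Module.length Λ K + 1 := by
  rw [← length_eq_of_covBy (covBy_top_iff.2 h), Module.length_top]

theorem exists_submodule_length_add [IsNoetherian Λ M] (c : ℕ) (hc : c ≤ Module.length Λ M) :
    ∃ K : Submodule Λ M, Module.length Λ K + c = Module.length Λ M := by
  induction c with
  | zero => exact ⟨⊤, by simp⟩
  | succ c ih =>
    obtain ⟨K, hK⟩ := ih (le_trans (by simp) hc)
    have hb : K ≠ ⊥ := by
      rintro rfl
      rw [Module.length_eq_zero, zero_add] at hK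
      rw [← hK] at hc
      norm_cast at hc
      omega
    obtain ⟨L, hL⟩ := exists_covBy_of_wellFoundedGT (a := K) (by rwa [isMin_iff_eq_bot])
    refine ⟨L, ?_⟩
    rw [← hK, length_eq_of_covBy hL]
    push_cast
    ring

section FiniteLength

variable [IsArtinian Λ M] [IsNoetherian Λ M]

theorem eq_of_le_of_length_le {K L : Submodule Λ M} (h : K ≤ L)
    (hl : Module.length Λ L ≤ Module.length Λ K) : K = L := by
  by_contra hne
  have := Submodule.height_strictMono (lt_of_le_of_ne h hne)
  rw [Module.length_submodule, Module.length_submodule] at hl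
  exact this.not_ge hl

theorem IsUniserial.le_of_length_le (h : IsUniserial Λ M) {K L : Submodule Λ M}
    (hl : Module.length Λ K ≤ Module.length Λ L) : K ≤ L :=
  (h K L).elim id fun h' => (eq_of_le_of_length_le h' hl).ge

end FiniteLength

theorem radPow_succ_smul (K : Submodule Λ M) (a : ℕ) :
    (radPow Λ (a + 1) : Ideal Λ) • K =
      Ring.jacobson Λ • ((radPow Λ a : Ideal Λ) • K) := by
  rw [← Submodule.smul_assoc]
  congr 1
  apply le_antisymm
  · refine Submodule.span_le.2 ?_
    rintro _ ⟨x, hx, y, hy, rfl⟩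
    rw [Ideal.jacobson_bot] at hx
    exact Submodule.smul_mem_smul hx hy
  · refine Submodule.smul_le.2 fun x hx y hy => Submodule.subset_span ⟨x, ?_, y, hy, rfl⟩
    rwa [Ideal.jacobson_bot]

theorem radPow_zero_smul (K : Submodule Λ M) : (radPow Λ 0 : Ideal Λ) • K = K :=
  Submodule.top_smul K

theorem length_radPow_smul_add_le [IsArtinian Λ M] [IsNoetherian Λ M] (K : Submodule Λ M) (a : ℕ)
    (h : (radPow Λ a : Ideal Λ) • K ≠ ⊥) :
    Module.length Λ ((radPow Λ a : Ideal Λ) • K : Submodule Λ M) + a ≤ Module.length Λ K := by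
  induction a with
  | zero => rw [radPow_zero_smul]; simp
  | succ a ih =>
    rw [radPow_succ_smul] at h ⊢
    have h0 : (radPow Λ a : Ideal Λ) • K ≠ ⊥ := by
      intro h0
      rw [h0, Submodule.smul_bot] at h
      exact h rfl
    have hlt := Submodule.FG.jacobson_smul_lt h0 (IsNoetherian.noetherian _)
    have := Submodule.height_strictMono hlt
    rw [← Module.length_submodule, ← Module.length_submodule] at this
    calc _ = (Module.length Λ (Ring.jacobson Λ • ((radPow Λ a : Ideal Λ) • K) : Submodule Λ M) + 1)
            + (a : ℕ∞) := by push_cast; ring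
      _ ≤ _ := by gcongr; exact Order.add_one_le_of_lt this
      _ ≤ _ := ih h0

theorem radPow_smul_eq_bot_of_length_le [IsArtinian Λ M] [IsNoetherian Λ M] (K : Submodule Λ M)
    (a : ℕ) (h : Module.length Λ K ≤ a) : (radPow Λ a : Ideal Λ) • K = ⊥ := by
  by_contra hne
  have h1 := (length_radPow_smul_add_le K a hne).trans h
  have : Nontrivial ((radPow Λ a : Ideal Λ) • K : Submodule Λ M) :=
    Submodule.nontrivial_iff_ne_bot.2 hne
  have h2 := Module.length_pos (R := Λ) (M := ((radPow Λ a : Ideal Λ) • K : Submodule Λ M))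
  generalize Module.length Λ ((radPow Λ a : Ideal Λ) • K : Submodule Λ M) = z at h1 h2
  cases z with
  | top => simp at h1
  | coe z => norm_cast at h1 h2; omega

theorem isSemisimpleModule_quotient_jacobson_smul [IsSemiprimaryRing Λ] :
    IsSemisimpleModule Λ (M ⧸ (Ring.jacobson Λ • ⊤ : Submodule Λ M)) := by
  have h : Module.IsTorsionBySet Λ (M ⧸ (Ring.jacobson Λ • ⊤ : Submodule Λ M))
      (Ring.jacobson Λ) :=
    (Module.isTorsionBySet_quotient_iff _ _).2
      fun m i hi ↦ Submodule.smul_mem_smul hi trivial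
  let _ := h.module
  exact (h.semilinearMap.isSemisimpleModule_iff_of_bijective Function.bijective_id).2
      inferInstance

theorem IsUniserial.length_le_one [IsSemisimpleModule Λ M] (h : IsUniserial Λ M) :
    Module.length Λ M ≤ 1 := by
  rcases subsingleton_or_nontrivial M with _ | _
  · rw [Module.length_eq_zero]; exact zero_le_one
  · refine (Module.length_eq_one_iff.2 ?_).le
    refine (isSimpleModule_iff Λ M).2 ⟨fun K => ?_⟩
    obtain ⟨L, hL⟩ := exists_isCompl K
    rcases h K L with h' | h'
    · exact Or.inl (le_bot_iff.1 (hL.1 le_rfl h'))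
    · exact Or.inr (top_le_iff.1 (hL.2 le_rfl h'))

theorem IsUniserial.length_le_jacobson_smul [IsSemiprimaryRing Λ] (h : IsUniserial Λ M) :
    Module.length Λ M ≤ Module.length Λ (Ring.jacobson Λ • ⊤ : Submodule Λ M) + 1 := by
  have := isSemisimpleModule_quotient_jacobson_smul (Λ := Λ) (M := M)
  have hq := Submodule.mkQ_surjective (Ring.jacobson Λ • ⊤ : Submodule Λ M)
  rw [← length_ker_add_length_of_surjective _ hq, Submodule.ker_mkQ]
  gcongr
  exact (h.of_surjective _ hq).length_le_one

theorem IsUniserial.length_le_radPow_smul_add [IsSemiprimaryRing Λ] (h : IsUniserial Λ M)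
    (K : Submodule Λ M) (a : ℕ) :
    Module.length Λ K ≤ Module.length Λ ((radPow Λ a : Ideal Λ) • K : Submodule Λ M) + a := by
  induction a with
  | zero => rw [radPow_zero_smul]; simp
  | succ a ih =>
    rw [radPow_succ_smul]
    set L := (radPow Λ a : Ideal Λ) • K
    have := (h.submodule L).length_le_jacobson_smul
    have e : Submodule.map L.subtype (Ring.jacobson Λ • ⊤) = Ring.jacobson Λ • L := by
      rw [Submodule.map_smul'', Submodule.map_top, Submodule.range_subtype]
    rw [← e, ← (Submodule.equivMapOfInjective L.subtype L.subtype_injective _).length_eq]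
    refine ih.trans ((add_le_add_left this _).trans (le_of_eq ?_))
    push_cast
    ring

end Uniserial

section ProjectiveSystem

variable {Λ} {ι : Type*} {P : ι → ModuleCat.{u} Λ}

/-- `P` lists, up to isomorphism and without repetition, the indecomposable projectives of `Λ`,
which are moreover assumed to be injective and uniserial. -/
structure IsProjSystem (P : ι → ModuleCat.{u} Λ) : Prop where
  finite : ∀ i, Module.Finite Λ (P i)
  projective : ∀ i, Module.Projective Λ (P i)
  injective : ∀ i, Module.Injective Λ (P i)
  nontrivial : ∀ i, Nontrivial (P i)
  uniserial : ∀ i, IsUniserial Λ (P i)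
  covers : ∀ (U : Type u) [AddCommGroup U] [Module Λ U] (K : Submodule Λ U), IsCoatom K →
    ∃ (i : ι) (f : P i →ₗ[Λ] U), ¬ LinearMap.range f ≤ K
  top_unique : ∀ (U : Type u) [AddCommGroup U] [Module Λ U] [Nontrivial U] (i j : ι)
    (f : P i →ₗ[Λ] U) (g : P j →ₗ[Λ] U), Function.Surjective f → Function.Surjective g → i = j

/-- The arrows of the quiver of `Λ`: the radical of `P i` is a nonzero quotient of `P j`. -/
def Arrow (P : ι → ModuleCat.{u} Λ) (i j : ι) : Prop :=
  ∃ f : P j →ₗ[Λ] P i, IsCoatom (LinearMap.range f) ∧ LinearMap.range f ≠ ⊥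

namespace IsProjSystem

variable (hP : IsProjSystem P) {U : Type u} [AddCommGroup U] [Module Λ U]

include hP

theorem eq_of_range_eq {i j : ι} (f : P i →ₗ[Λ] U) (g : P j →ₗ[Λ] U)
    (h : LinearMap.range f = LinearMap.range g) (hne : LinearMap.range f ≠ ⊥) : i = j := by
  have := Submodule.nontrivial_iff_ne_bot.2 hne
  exact hP.top_unique (LinearMap.range f) i j f.rangeRestrict
    (g.codRestrict _ fun x => h ▸ LinearMap.mem_range_self g x) f.surjective_rangeRestrict
    fun ⟨y, hy⟩ => by
      obtain ⟨x, rfl⟩ := h ▸ hy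
      exact ⟨x, rfl⟩

theorem exists_cover [Module.Finite Λ U] [Nontrivial U] (hU : IsUniserial Λ U) :
    ∃ (i : ι) (f : P i →ₗ[Λ] U), Function.Surjective f := by
  obtain ⟨K, hK, -⟩ := (eq_top_or_exists_le_coatom (⊥ : Submodule Λ U)).resolve_left bot_ne_top
  obtain ⟨i, f, hf⟩ := hP.covers U K hK
  exact ⟨i, f, hU.surjective_of_not_le hK hf⟩

theorem exists_range_eq [IsNoetherian Λ U] (hU : IsUniserial Λ U) {K : Submodule Λ U}
    (hK : K ≠ ⊥) : ∃ (i : ι) (f : P i →ₗ[Λ] U), LinearMap.range f = K := by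
  have := Submodule.nontrivial_iff_ne_bot.2 hK
  obtain ⟨i, f, hf⟩ := hP.exists_cover (hU.submodule K)
  refine ⟨i, K.subtype.comp f, ?_⟩
  rw [LinearMap.range_comp, LinearMap.range_eq_top.2 hf, Submodule.map_top,
    Submodule.range_subtype]

theorem iSup_range_eq_top [Module.Finite Λ U] :
    ⨆ q : Σ i, P i →ₗ[Λ] U, LinearMap.range q.2 = ⊤ := by
  by_contra h
  obtain ⟨K, hK, hle⟩ := (eq_top_or_exists_le_coatom _).resolve_left h
  obtain ⟨i, f, hf⟩ := hP.covers U K hK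
  exact hf ((le_iSup (fun q : Σ i, P i →ₗ[Λ] U => LinearMap.range q.2) ⟨i, f⟩).trans hle)

theorem arrow_left_unique {i j k : ι} (hi : Arrow P i k) (hj : Arrow P j k) : i = j := by
  obtain ⟨f, hf, hf0⟩ := hi
  obtain ⟨g, hg, hg0⟩ := hj
  wlog hker : LinearMap.ker f ≤ LinearMap.ker g generalizing i j
  · exact (this g hg hg0 f hf hf0 ((hP.uniserial k _ _).resolve_left hker)).symm
  have := hP.injective j
  have := hP.nontrivial j
  obtain ⟨h, hh⟩ := Module.Injective.extension_property Λ (P j) _ _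
    ((LinearMap.ker f).liftQ f le_rfl)
    (LinearMap.ker_eq_bot.1 (Submodule.ker_liftQ_eq_bot _ _ _ le_rfl))
    ((LinearMap.ker f).liftQ g hker)
  have hfg : ∀ x, h (f x) = g x := fun x => by
    simpa using LinearMap.congr_fun hh (Submodule.Quotient.mk x)
  have hle : LinearMap.range g ≤ LinearMap.range h := by
    rintro _ ⟨x, rfl⟩
    exact ⟨f x, hfg x⟩
  rcases hg.le_iff.1 hle with htop | heq
  · exact hP.top_unique (P j) i j h LinearMap.id (LinearMap.range_eq_top.1 htop)
      Function.surjective_id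
  · exfalso
    rcases hP.uniserial i (LinearMap.ker h) (LinearMap.range f) with hle' | hle'
    · refine hf.1 (eq_top_iff.2 fun y _ => ?_)
      obtain ⟨x, hx⟩ := heq ▸ LinearMap.mem_range_self h y
      have : y - f x ∈ LinearMap.ker h := by simp [hfg, hx]
      simpa using add_mem (hle' this) (LinearMap.mem_range_self f x)
    · refine hg0 (LinearMap.range_eq_bot.2 ?_)
      ext x
      rw [← hfg]
      exact hle' (LinearMap.mem_range_self f x)

theorem arrow_right_unique {i j k : ι} (hj : Arrow P i j) (hk : Arrow P i k) : j = k := by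
  obtain ⟨f, hf, hf0⟩ := hj
  obtain ⟨g, hg, -⟩ := hk
  exact hP.eq_of_range_eq f g ((hP.uniserial i).coatom_unique hf hg) hf0

theorem length_le_of_arrow {i j : ι} (h : Arrow P i j) :
    Module.length Λ (P i) ≤ Module.length Λ (P j) := by
  obtain ⟨f, hf, -⟩ := h
  rw [length_eq_of_isCoatom hf, ← length_ker_add_length_range f, add_comm]
  gcongr
  rw [Order.one_le_iff_pos, Module.length_pos_iff, Submodule.nontrivial_iff_ne_bot]
  intro hker
  have := hP.injective j
  have := hP.nontrivial j
  obtain ⟨h, hh⟩ := Module.Injective.extension_property Λ (P j) _ _ f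
    (LinearMap.ker_eq_bot.1 hker) LinearMap.id
  have hfh : ∀ x, h (f x) = x := LinearMap.congr_fun hh
  rcases hP.uniserial i (LinearMap.ker h) (LinearMap.range f) with hle' | hle'
  · refine hf.1 (eq_top_iff.2 fun y _ => ?_)
    have : y - f (h y) ∈ LinearMap.ker h := by simp [hfh]
    simpa using add_mem (hle' this) (LinearMap.mem_range_self f (h y))
  · obtain ⟨x, hx⟩ := exists_ne (0 : P j)
    exact hx ((hfh x).symm.trans (hle' (LinearMap.mem_range_self f x)))

theorem exists_arrow [IsNoetherianRing Λ] {i : ι} (h : 1 < Module.length Λ (P i)) :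
    ∃ j, Arrow P i j := by
  have := hP.finite i
  have := hP.nontrivial i
  obtain ⟨K, hK, -⟩ :=
    (eq_top_or_exists_le_coatom (⊥ : Submodule Λ (P i))).resolve_left bot_ne_top
  have hK0 : K ≠ ⊥ := by
    rintro rfl
    rw [length_eq_of_isCoatom hK, Module.length_eq_zero] at h
    simp at h
  obtain ⟨j, f, hf⟩ := hP.exists_range_eq (hP.uniserial i) hK0
  exact ⟨j, f, hf ▸ hK, hf ▸ hK0⟩

theorem arrow_of_covBy {i k : ι} (f : P i →ₗ[Λ] U) (g : P k →ₗ[Λ] U)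
    (h : LinearMap.range f ⋖ LinearMap.range g) (hf : LinearMap.range f ≠ ⊥) : Arrow P k i := by
  have := hP.projective i
  obtain ⟨f', hf'⟩ := Module.projective_lifting_property g.rangeRestrict
    (f.codRestrict _ fun x => h.le (LinearMap.mem_range_self f x)) g.surjective_rangeRestrict
  have hgf : g.comp f' = f := by
    ext x
    simpa using congr(($hf' x : U))
  have hmap : (LinearMap.range f').map g = LinearMap.range f := by
    rw [← hgf, LinearMap.range_comp]
  have hker : LinearMap.ker g ≤ LinearMap.range f' := by
    refine (hP.uniserial k _ _).resolve_right fun hle => hf ?_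
    rw [← hmap, eq_bot_iff, Submodule.map_le_iff_le_comap]
    exact hle
  refine ⟨f', ⟨fun htop => h.ne ?_, fun L hL => ?_⟩, fun hbot => hf ?_⟩
  · rw [← hmap, htop, Submodule.map_top]
  · have hkL := hker.trans hL.le
    have h1 : LinearMap.range f ≤ L.map g := hmap ▸ Submodule.map_mono hL.le
    have h2 : L.map g ≤ LinearMap.range g := LinearMap.map_le_range
    rcases h.wcovBy.eq_or_eq h1 h2 with e | e
    · exfalso
      refine hL.not_ge ?_
      rw [← Submodule.comap_map_eq_self hkL, e, ← hmap, Submodule.comap_map_eq_self hker]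
    · rw [← Submodule.comap_map_eq_self hkL, e, eq_top_iff]
      exact fun x _ => LinearMap.mem_range_self g x
  · rw [← hmap, hbot, Submodule.map_bot]

theorem mem_iff_of_ne_zero [IsNoetherianRing Λ] [IsArtinianRing Λ] {A : Set ι}
    (hA : ∀ i j, Arrow P i j → (i ∈ A ↔ j ∈ A)) {i j : ι} (f : P i →ₗ[Λ] P j) (hf : f ≠ 0) :
    i ∈ A ↔ j ∈ A := by
  have := hP.finite j
  obtain ⟨K, hK⟩ : ∃ K, LinearMap.range f = K := ⟨_, rfl⟩
  induction K using WellFoundedGT.induction generalizing i with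
  | _ K ih =>
  have hK0 : LinearMap.range f ≠ ⊥ := mt LinearMap.range_eq_bot.1 hf
  by_cases htop : LinearMap.range f = ⊤
  · rw [hP.eq_of_range_eq f (LinearMap.id : P j →ₗ[Λ] P j) (by rw [htop, LinearMap.range_id]) hK0]
  · obtain ⟨L, hL⟩ := exists_covBy_of_wellFoundedLT (a := LinearMap.range f)
      (by rwa [isMax_iff_eq_top])
    obtain ⟨k, g, rfl⟩ := hP.exists_range_eq (hP.uniserial j) (ne_bot_of_le_ne_bot hK0 hL.le)
    rw [← hA k i (hP.arrow_of_covBy f g hL hK0)]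
    refine ih _ (hK ▸ hL.lt) g ?_ rfl
    rintro rfl
    exact hK0 (le_bot_iff.1 (by simpa using hL.le))

omit hP in
theorem mul_eq_zero_of_mem_trace {A B : Set ι}
    (hAB : ∀ i ∈ A, ∀ j ∈ B, ∀ f : P i →ₗ[Λ] P j, f = 0) {x : Λ}
    (hx : x ∈ ⨆ q : Σ i : A, P i →ₗ[Λ] Λ, LinearMap.range q.2)
    {j : ι} (hj : j ∈ B) (p : P j) : x • p = 0 := by
  induction hx using Submodule.iSup_induction' with
  | mem q x hx =>
    obtain ⟨z, rfl⟩ := hx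
    exact LinearMap.congr_fun
      (hAB q.1 q.1.2 j hj ((LinearMap.toSpanSingleton Λ (P j) p).comp q.2)) z
  | zero => simp
  | add x y _ _ hx hy => rw [add_smul, hx, hy, add_zero]

/-- A union of connected components of the quiver of a connected algebra is everything. -/
theorem eq_univ_of_closed [IsNoetherianRing Λ] [IsArtinianRing Λ]
    (hconn : ∀ e : Λ, IsIdempotentElem e → e ∈ Set.center Λ → e = 0 ∨ e = 1) {A : Set ι}
    (hA : ∀ i j, Arrow P i j → (i ∈ A ↔ j ∈ A)) (hne : A.Nonempty) : A = Set.univ := by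
  let T (B : Set ι) : Submodule Λ Λ := ⨆ q : Σ i : B, P i →ₗ[Λ] Λ, LinearMap.range q.2
  have h1 : ∀ i ∈ A, ∀ j ∈ Aᶜ, ∀ f : P i →ₗ[Λ] P j, f = 0 := fun i hi j hj f => by
    by_contra hf
    exact hj ((hP.mem_iff_of_ne_zero hA f hf).1 hi)
  have h2 : ∀ i ∈ Aᶜ, ∀ j ∈ A, ∀ f : P i →ₗ[Λ] P j, f = 0 := fun i hi j hj f => by
    by_contra hf
    exact hi ((hP.mem_iff_of_ne_zero hA f hf).2 hj)
  have hann {B C : Set ι} (h : ∀ i ∈ B, ∀ j ∈ C, ∀ f : P i →ₗ[Λ] P j, f = 0) {x y : Λ}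
      (hx : x ∈ T B) (hy : y ∈ T C) : x * y = 0 := by
    induction hy using Submodule.iSup_induction' with
    | mem q y hy =>
      obtain ⟨z, rfl⟩ := hy
      rw [← smul_eq_mul, ← map_smul, mul_eq_zero_of_mem_trace h hx q.1.2, map_zero]
    | zero => simp
    | add y z _ _ hy hz => rw [mul_add, hy, hz, add_zero]
  have hright {B : Set ι} {x : Λ} (hx : x ∈ T B) (z : Λ) : x * z ∈ T B := by
    induction hx using Submodule.iSup_induction' with
    | mem q x hx =>
      obtain ⟨w, rfl⟩ := hx
      exact Submodule.mem_iSup_of_mem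
        ⟨q.1, (LinearMap.toSpanSingleton Λ Λ z).comp q.2⟩ ⟨w, rfl⟩
    | zero => simp
    | add x y _ _ hx hy => rw [add_mul]; exact add_mem hx hy
  have htop : (1 : Λ) ∈ T A ⊔ T Aᶜ := by
    have : (⊤ : Submodule Λ Λ) ≤ T A ⊔ T Aᶜ := by
      rw [← hP.iSup_range_eq_top]
      refine iSup_le fun q => ?_
      by_cases hq : q.1 ∈ A
      · exact le_sup_of_le_left
          (le_iSup (fun q : Σ i : A, P i →ₗ[Λ] Λ => LinearMap.range q.2) ⟨⟨q.1, hq⟩, q.2⟩)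
      · exact le_sup_of_le_right
          (le_iSup (fun q : Σ i : (Aᶜ : Set ι), P i →ₗ[Λ] Λ => LinearMap.range q.2)
            ⟨⟨q.1, hq⟩, q.2⟩)
    exact this trivial
  obtain ⟨a, ha, b, hb, hab⟩ := Submodule.mem_sup.1 htop
  have hidem : a * a = a := by
    have := hann h1 ha hb
    calc a * a = a * a + a * b := by rw [this, add_zero]
      _ = a := by rw [← mul_add, hab, mul_one]
  have hcent : ∀ z, a * z = z * a := fun z => by
    have e1 : a * z * b = 0 := hann h1 (hright ha z) hb
    have e2 : b * (z * a) = 0 := hann h2 hb ((T A).smul_mem z ha)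
    calc a * z = a * z * (a + b) := by rw [hab, mul_one]
      _ = (a + b) * (z * a) := by rw [mul_add, add_mul, e1, e2]; simp [mul_assoc]
      _ = z * a := by rw [hab, one_mul]
  rcases hconn a hidem (Semigroup.mem_center_iff.2 fun z => (hcent z).symm) with h0 | h0
  · exfalso
    obtain ⟨i, hi⟩ := hne
    have := hP.nontrivial i
    obtain ⟨p, hp⟩ := exists_ne (0 : P i)
    rw [h0, zero_add] at hab
    refine hp ?_
    rw [← one_smul Λ p, ← hab]
    exact mul_eq_zero_of_mem_trace h2 hb hi p
  · refine Set.eq_univ_of_forall fun i => ?_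
    by_contra hi
    have := hP.nontrivial i
    obtain ⟨p, hp⟩ := exists_ne (0 : P i)
    refine hp ?_
    rw [← one_smul Λ p, ← h0]
    exact mul_eq_zero_of_mem_trace h1 ha hi p

end IsProjSystem

end ProjectiveSystem

section Cycle

namespace IsProjSystem

variable {Λ} [IsArtinianRing Λ] {ι : Type*}
  {P : ι → ModuleCat.{u} Λ} (hP : IsProjSystem P)
include hP

theorem length_eq_of_connected [Finite ι]
    (hconn : ∀ e : Λ, IsIdempotentElem e → e ∈ Set.center Λ → e = 0 ∨ e = 1) {m : ℕ} (hm : 1 < m)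
    (hle : ∀ i, Module.length Λ (P i) ≤ m) (hex : ∃ i, Module.length Λ (P i) = m) (i : ι) :
    Module.length Λ (P i) = m := by
  let L : Set ι := {i | Module.length Λ (P i) = m}
  have hfwd : ∀ i j, Arrow P i j → i ∈ L → j ∈ L := fun i j h hi =>
    le_antisymm (hle j) (le_of_eq_of_le (Eq.symm hi) (hP.length_le_of_arrow h))
  have hsucc : ∀ i : L, ∃ j : L, Arrow P i j := fun i => by
    obtain ⟨j, hj⟩ := hP.exists_arrow (i := i) (by rw [i.2]; exact_mod_cast hm)
    exact ⟨⟨j, hfwd _ _ hj i.2⟩, hj⟩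
  choose σ hσ using hsucc
  have hinj : Function.Injective σ := fun i j h =>
    Subtype.ext (hP.arrow_left_unique (hσ i) (h ▸ hσ j))
  have hsurj := Finite.surjective_of_injective hinj
  have hL : L = Set.univ := by
    refine hP.eq_univ_of_closed hconn (fun i j h => ⟨hfwd i j h, fun hj => ?_⟩) hex
    obtain ⟨k, hk⟩ := hsurj ⟨j, hj⟩
    have hkj := hσ k
    rw [hk] at hkj
    rw [hP.arrow_left_unique h hkj]
    exact k.2
  have hi : i ∈ L := hL ▸ Set.mem_univ i
  exact hi

theorem exists_cycle [Fintype ι]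
    (hconn : ∀ e : Λ, IsIdempotentElem e → e ∈ Set.center Λ → e = 0 ∨ e = 1)
    (hlen : ∀ i, 1 < Module.length Λ (P i)) :
    ∃ σ : ι → ι, (∀ i, Arrow P i (σ i)) ∧
      ∀ i a b, σ^[a] i = σ^[b] i ↔ a ≡ b [MOD Fintype.card ι] := by
  choose σ hσ using fun i => hP.exists_arrow (hlen i)
  have hinj : Function.Injective σ := fun i j h =>
    hP.arrow_left_unique (hσ i) (h ▸ hσ j)
  refine ⟨σ, hσ, fun i a b => ?_⟩
  have hper : i ∈ Function.periodicPts σ := hinj.mem_periodicPts i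
  have hp := Function.minimalPeriod_pos_of_mem_periodicPts hper
  have horb : Set.range (fun a => σ^[a] i) = Set.univ := by
    refine hP.eq_univ_of_closed hconn (fun j k h => ?_) ⟨i, 0, rfl⟩
    have hk : σ j = k := hP.arrow_right_unique (hσ j) h
    subst hk
    refine ⟨fun ⟨a, ha⟩ => ⟨a + 1, ?_⟩, fun ⟨a, ha⟩ => ⟨a + Function.minimalPeriod σ i - 1, ?_⟩⟩
    · simp only at ha ⊢
      rw [Function.iterate_succ_apply', ha]
    · apply hinj
      simp only at ha ⊢
      rw [← Function.iterate_succ_apply' σ,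
        show (a + Function.minimalPeriod σ i - 1).succ = a + Function.minimalPeriod σ i by omega,
        Function.iterate_add_minimalPeriod_eq, ha]
  have hcard : Function.minimalPeriod σ i = Fintype.card ι := by
    rw [← Fintype.card_fin (Function.minimalPeriod σ i)]
    refine Fintype.card_of_bijective (f := fun c : Fin _ => σ^[c] i) ⟨fun c c' h => ?_, fun j => ?_⟩
    · exact Fin.ext (Function.iterate_injOn_Iio_minimalPeriod c.2 c'.2 h)
    · obtain ⟨a, rfl⟩ : j ∈ Set.range (fun a => σ^[a] i) := horb ▸ Set.mem_univ j
      exact ⟨⟨a % _, Nat.mod_lt _ hp⟩, Function.iterate_mod_minimalPeriod_eq⟩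
  rw [← hcard, Nat.ModEq, ← Function.iterate_mod_minimalPeriod_eq (n := a),
    ← Function.iterate_mod_minimalPeriod_eq (n := b)]
  exact Function.iterate_eq_iterate_iff_of_lt_minimalPeriod (Nat.mod_lt _ hp) (Nat.mod_lt _ hp)

theorem length_le_of_radPow_eq_bot {m : ℕ} (h : radPow Λ m = ⊥) (i : ι) :
    Module.length Λ (P i) ≤ m := by
  have h' : (radPow Λ m : Ideal Λ) = ⊥ := h
  have := (hP.uniserial i).length_le_radPow_smul_add ⊤ m
  rwa [h', Submodule.bot_smul, Module.length_top, Module.length_bot, zero_add] at this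

theorem exists_lt_length_of_radPow_ne_bot {a : ℕ} (h : radPow Λ a ≠ ⊥) :
    ∃ i, a < Module.length Λ (P i) := by
  by_contra! hle
  refine h (eq_bot_iff.2 fun x hx => ?_)
  have hmul : ∀ y ∈ ⨆ q : Σ i, P i →ₗ[Λ] Λ, LinearMap.range q.2, x * y = 0 := fun y hy => by
    induction hy using Submodule.iSup_induction' with
    | mem q y hy =>
      obtain ⟨z, rfl⟩ := hy
      have := hP.finite q.1
      have hz : x • z ∈ ((radPow Λ a : Ideal Λ) • ⊤ : Submodule Λ (P q.1)) :=
        Submodule.smul_mem_smul hx trivial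
      rw [radPow_smul_eq_bot_of_length_le ⊤ a (by simpa using hle q.1), Submodule.mem_bot] at hz
      rw [← smul_eq_mul, ← map_smul, hz, map_zero]
    | zero => simp
    | add y z _ _ hy hz => rw [mul_add, hy, hz, add_zero]
  simpa using hmul 1 (hP.iSup_range_eq_top (U := Λ) ▸ trivial)

end IsProjSystem

end Cycle

section Syzygies

/-- The number of radical layers by which `j + 1` successive syzygies of a module of length `r`
shift its top, when all indecomposable projectives have length `m`. -/
def syzygyShift (m : ℕ) : ℕ → ℕ → ℕ
  | 0, r => r
  | j + 1, r => r + syzygyShift m j (m - r)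

theorem syzygyShift_two_mul {m t : ℕ} (h : t ≤ m) (i : ℕ) :
    syzygyShift m (2 * i) t = i * m + t := by
  induction i with
  | zero => simp [syzygyShift]
  | succ i ih =>
    rw [show 2 * (i + 1) = 2 * i + 1 + 1 by ring, syzygyShift, syzygyShift, Nat.sub_sub_self h, ih]
    ring_nf
    omega

theorem syzygyShift_two_mul_add_one {m t : ℕ} (h : t ≤ m) (i : ℕ) :
    syzygyShift m (2 * i + 1) t = (i + 1) * m := by
  have h' := syzygyShift_two_mul (Nat.sub_le m t) i
  rw [syzygyShift, h']
  ring_nf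
  omega

namespace IsProjSystem

variable {Λ} [IsArtinianRing Λ] {ι : Type*}
  {P : ι → ModuleCat.{u} Λ} (hP : IsProjSystem P) {σ : ι → ι} (hσ : ∀ i, Arrow P i (σ i))
  {U X W : Type u} [AddCommGroup U] [Module Λ U] [AddCommGroup X] [Module Λ X]
  [AddCommGroup W] [Module Λ W]
include hP hσ

theorem exists_range_eq_of_length_add {x : ι} {g : P x →ₗ[Λ] U}
    (hg : Function.Surjective g) (a : ℕ) {N : Submodule Λ U} (hN : N ≠ ⊥)
    (hlen : Module.length Λ N + a = Module.length Λ U) :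
    ∃ f : P (σ^[a] x) →ₗ[Λ] U, LinearMap.range f = N := by
  have := hP.finite x
  have : Module.Finite Λ U := .of_surjective g hg
  have hU := (hP.uniserial x).of_surjective g hg
  induction a generalizing N with
  | zero =>
    have h : LinearMap.range g = N := by
      rw [LinearMap.range_eq_top.2 hg]
      exact (eq_of_le_of_length_le le_top (by simp [← hlen])).symm
    exact ⟨g, h⟩
  | succ a ih =>
    have htop : N ≠ ⊤ := by
      rintro rfl
      rw [Module.length_top] at hlen
      have := Module.length_ne_top (R := Λ) (M := U)
      generalize Module.length Λ U = z at *
      lift z to ℕ using this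
      norm_cast at hlen
      omega
    obtain ⟨N', hN'⟩ := exists_covBy_of_wellFoundedLT (a := N) (by rwa [isMax_iff_eq_top])
    obtain ⟨g', rfl⟩ := ih (N := N') (ne_bot_of_le_ne_bot hN hN'.le) (by
      rw [length_eq_of_covBy hN', ← hlen]
      push_cast
      ring)
    obtain ⟨i, f, rfl⟩ := hP.exists_range_eq hU hN
    obtain rfl := hP.arrow_right_unique (hP.arrow_of_covBy f g' hN' hN) (hσ _)
    rw [Function.iterate_succ_apply']
    exact ⟨f, rfl⟩

theorem exists_linearMap_ne_zero_iff {x p : ι} {f : P x →ₗ[Λ] X} (hf : Function.Surjective f)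
    {w : P p →ₗ[Λ] W} (hw : Function.Surjective w) {t : ℕ} (ht : Module.length Λ X = t)
    (hle : t ≤ Module.length Λ W) :
    (∃ h : W →ₗ[Λ] X, h ≠ 0) ↔ ∃ c < t, σ^[c] x = p := by
  have := hP.finite x
  have := hP.finite p
  have : Module.Finite Λ X := .of_surjective f hf
  constructor
  · rintro ⟨h, hh⟩
    have hr : LinearMap.range h ≠ ⊥ := mt LinearMap.range_eq_bot.1 hh
    have hpos : 0 < Module.length Λ (LinearMap.range h) :=
      Module.length_pos_iff.2 (Submodule.nontrivial_iff_ne_bot.2 hr)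
    have hlet := Module.length_le_of_injective _ (LinearMap.range h).subtype_injective
    rw [ht] at hlet
    obtain ⟨b, hb⟩ := ENat.ne_top_iff_exists.1 (ne_top_of_le_ne_top (ENat.natCast_ne_top t) hlet)
    rw [← hb] at hpos hlet
    norm_cast at hpos hlet
    obtain ⟨f', hf'⟩ := hP.exists_range_eq_of_length_add hσ hf (t - b) hr (by
      rw [ht, ← hb]
      norm_cast
      omega)
    refine ⟨t - b, by omega, hP.eq_of_range_eq f' (h.comp w) ?_ (hf' ▸ hr)⟩
    rw [hf', LinearMap.range_comp, LinearMap.range_eq_top.2 hw, Submodule.map_top]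
  · rintro ⟨c, hc, rfl⟩
    obtain ⟨N, hN⟩ := exists_submodule_length_add (Λ := Λ) (M := X) c
      (by rw [ht]; exact_mod_cast hc.le)
    have hN0 : N ≠ ⊥ := by
      rintro rfl
      rw [Module.length_bot, ht] at hN
      norm_cast at hN
      omega
    obtain ⟨f', rfl⟩ := hP.exists_range_eq_of_length_add hσ hf c hN0 hN
    have hker : LinearMap.ker w ≤ LinearMap.ker f' := by
      refine (hP.uniserial _).le_of_length_le ?_
      have h1 := length_ker_add_length_of_surjective w hw
      rw [← length_ker_add_length_range f'] at h1
      have h2 : Module.length Λ (LinearMap.range f') ≤ Module.length Λ W := by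
        refine le_trans ?_ (ht ▸ hle)
        exact Module.length_le_of_injective _ (Submodule.subtype_injective _)
      have h3 := Module.length_ne_top (R := Λ) (M := LinearMap.range f')
      refine (ENat.add_le_add_iff_right h3).1 ?_
      rw [← h1]
      gcongr
    refine ⟨((LinearMap.ker w).liftQ f' hker).comp
      (w.quotKerEquivOfSurjective hw).symm.toLinearMap, fun h => hN0 ?_⟩
    rw [LinearMap.range_eq_bot]
    ext y
    have := LinearMap.congr_fun h (w y)
    have e : (w.quotKerEquivOfSurjective hw).symm (w y) = Submodule.Quotient.mk y := by
      rw [LinearEquiv.symm_apply_eq]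
      rfl
    simpa [e] using this

variable [HasExt.{u} (ModuleCat.{u} Λ)]

theorem subsingleton_ext_iff {m t : ℕ} (hlen : ∀ i, Module.length Λ (P i) = m) {x : ι}
    {X : ModuleCat.{u} Λ} {f : P x →ₗ[Λ] X} (hf : Function.Surjective f)
    (hX : Module.length Λ X = t) (ht : 0 < t) (htm : 2 * t ≤ m) (j e r : ℕ)
    {M : ModuleCat.{u} Λ} {g : P (σ^[e] x) →ₗ[Λ] M} (hg : Function.Surjective g)
    (hM : Module.length Λ M = r) (hr : r = t ∨ r + t = m) :
    Subsingleton (Abelian.Ext.{u} M X (j + 1)) ↔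
      ¬ ∃ c < t, σ^[c] x = σ^[e + syzygyShift m j r] x := by
  have := hP.finite (σ^[e] x)
  have := hP.projective (σ^[e] x)
  have hK : Module.length Λ (LinearMap.ker g) = (m - r : ℕ) := by
    have h := length_ker_add_length_of_surjective g hg
    rw [hM, hlen] at h
    obtain ⟨b, hb⟩ := ENat.ne_top_iff_exists.1 (Module.length_ne_top (R := Λ)
      (M := LinearMap.ker g))
    rw [← hb] at h ⊢
    norm_cast at h ⊢
    omega
  have hK0 : LinearMap.ker g ≠ ⊥ := by
    intro h
    rw [h, Module.length_bot] at hK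
    norm_cast at hK
    omega
  obtain ⟨g', hg'⟩ : ∃ g' : P (σ^[e + r] x) →ₗ[Λ] P (σ^[e] x),
      LinearMap.range g' = LinearMap.ker g := by
    rw [add_comm, Function.iterate_add_apply]
    exact hP.exists_range_eq_of_length_add hσ (x := σ^[e] x) (g := LinearMap.id)
      Function.surjective_id r hK0 (by rw [hK, hlen]; norm_cast; omega)
  obtain ⟨p, hp⟩ : ∃ p : P (σ^[e + r] x) →ₗ[Λ] LinearMap.ker g, Function.Surjective p :=
    ⟨g'.codRestrict _ fun y => hg' ▸ LinearMap.mem_range_self g' y, fun ⟨y, hy⟩ => by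
      obtain ⟨z, rfl⟩ := hg' ▸ hy
      exact ⟨z, rfl⟩⟩
  cases j with
  | zero =>
    rw [zero_add, subsingleton_ext_one_iff_ker g hg X fun h => ?_, syzygyShift,
      ← hP.exists_linearMap_ne_zero_iff hσ hf hp hX (by rw [hK]; norm_cast; omega)]
    · push Not
      rfl
    · refine (hP.uniserial _).le_of_length_le ?_
      have h1 := length_ker_add_length_of_surjective g hg
      rw [← length_ker_add_length_range h, hM] at h1
      have h2 := Module.length_le_of_injective _ (LinearMap.range h).subtype_injective
      rw [hX] at h2
      refine (ENat.add_le_add_iff_right (ENat.natCast_ne_top r)).1 ?_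
      rw [h1]
      gcongr
      exact h2.trans (by norm_cast; omega)
  | succ j =>
    rw [subsingleton_ext_ker_iff g hg, syzygyShift, ← add_assoc]
    exact subsingleton_ext_iff hlen hf hX ht htm j (e + r) (m - r) hp hK (by omega)

end IsProjSystem

end Syzygies

section SelfInjective

variable {Λ}

/-- `Q` is a finitely generated projective-injective module mapping onto `S`. -/
def IsProjInjCover (S Q : ModuleCat.{u} Λ) : Prop :=
  Module.Finite Λ Q ∧ Projective Q ∧ Injective Q ∧
    ∃ f : Q →ₗ[Λ] S, Function.Surjective f

theorem IsProjInjCover.of_retract {S Q A : ModuleCat.{u} Λ} [IsSimpleModule Λ S]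
    (hQ : IsProjInjCover S Q) (h : Retract A Q) (f : Q ⟶ S) (hf : h.i ≫ f ≠ 0) :
    IsProjInjCover S A := by
  obtain ⟨_, _, _, -⟩ := hQ
  have := (ModuleCat.epi_iff_surjective h.r).1 inferInstance
  refine ⟨.of_surjective h.r.hom this, h.projective, h.injective, (h.i ≫ f).hom,
    (LinearMap.surjective_or_eq_zero _).resolve_right fun h0 => hf (ModuleCat.hom_ext h0)⟩

theorem isZero_of_iso_biprod [IsArtinianRing Λ] {S Q A B : ModuleCat.{u} Λ} [IsSimpleModule Λ S]
    (hQ : IsProjInjCover S Q)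
    (hmin : ∀ Q', IsProjInjCover S Q' → Module.length Λ Q ≤ Module.length Λ Q')
    (e : Q ≅ A ⊞ B) (f : Q ⟶ S) (hf : biprod.inl ≫ e.inv ≫ f ≠ 0) : IsZero B := by
  have hA : IsProjInjCover S A := hQ.of_retract
    (h := { i := biprod.inl ≫ e.inv, r := e.hom ≫ biprod.fst }) f (by simpa using hf)
  have hlen : Module.length Λ Q = Module.length Λ A + Module.length Λ B := by
    rw [← Module.length_prod]
    exact (e ≪≫ ModuleCat.biprodIsoProd A B).toLinearEquiv.length_eq
  have := hA.1
  have hle := hmin A hA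
  rw [hlen] at hle
  have h0 : Module.length Λ B = 0 := by
    have := Module.length_ne_top (R := Λ) (M := A)
    refine le_antisymm ((ENat.add_le_add_iff_left this).1 ?_) bot_le
    rwa [add_zero]
  have := Module.length_eq_zero_iff.1 h0
  exact ModuleCat.isZero_of_subsingleton B

theorem exists_indec_cover [IsArtinianRing Λ] (hinj : Injective (ModuleCat.of Λ Λ))
    (S : ModuleCat.{u} Λ) [IsSimpleModule Λ S] : ∃ Q, IsProjInjCover S Q ∧ Indec Λ Q := by
  have := IsSimpleModule.nontrivial Λ S
  have hne : {Q : ModuleCat.{u} Λ | IsProjInjCover S Q}.Nonempty := by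
    obtain ⟨x, hx⟩ := exists_ne (0 : S)
    exact ⟨ModuleCat.of Λ Λ, inferInstanceAs (Module.Finite Λ Λ),
      (IsProjective.iff_projective (ModuleCat.of Λ Λ)).1 (inferInstanceAs (Module.Projective Λ Λ)),
      hinj, _, IsSimpleModule.toSpanSingleton_surjective Λ hx⟩
  obtain ⟨Q, hQ, hmin⟩ := (InvImage.wf (fun Q : ModuleCat.{u} Λ => Module.length Λ Q)
    wellFounded_lt).has_min _ hne
  replace hmin : ∀ Q', IsProjInjCover S Q' → Module.length Λ Q ≤ Module.length Λ Q' :=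
    fun Q' hQ' => not_lt.1 (hmin Q' hQ')
  obtain ⟨f, hf⟩ := hQ.2.2.2
  have hf0 : ModuleCat.ofHom f ≠ 0 := fun h0 => by
    obtain ⟨x, hx⟩ := exists_ne (0 : S)
    obtain ⟨y, rfl⟩ := hf x
    exact hx congr($(h0) y)
  refine ⟨Q, hQ, fun h0 => hf0 (h0.eq_of_src _ _), fun A B ⟨e⟩ => ?_⟩
  by_cases hl : biprod.inl ≫ e.inv ≫ ModuleCat.ofHom f = 0
  · refine Or.inl (isZero_of_iso_biprod hQ hmin (e ≪≫ biprod.braiding A B) (ModuleCat.ofHom f)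
      fun hr => hf0 ?_)
    rw [← cancel_epi e.inv, comp_zero]
    refine biprod.hom_ext' _ _ (by simpa using hl) ?_
    have hb : (biprod.inl : B ⟶ B ⊞ A) ≫ (biprod.braiding A B).inv = biprod.inr := by
      apply biprod.hom_ext <;> simp
    rw [Iso.trans_inv, Category.assoc, reassoc_of% hb] at hr
    simpa using hr
  · exact Or.inr (isZero_of_iso_biprod hQ hmin e _ hl)

theorem isCoatom_ker {M N : Type*} [AddCommGroup M] [Module Λ M] [AddCommGroup N] [Module Λ N]
    [IsSimpleModule Λ N] {f : M →ₗ[Λ] N} (hf : Function.Surjective f) :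
    IsCoatom (LinearMap.ker f) :=
  isSimpleModule_iff_isCoatom.1 (.congr (f.quotKerEquivOfSurjective hf))

theorem IsUniserial.nonempty_equiv {M N N' : Type*} [AddCommGroup M] [Module Λ M]
    [AddCommGroup N] [Module Λ N] [AddCommGroup N'] [Module Λ N'] [IsSimpleModule Λ N]
    [IsSimpleModule Λ N'] (h : IsUniserial Λ M) {f : M →ₗ[Λ] N} (hf : Function.Surjective f)
    {f' : M →ₗ[Λ] N'} (hf' : Function.Surjective f') : Nonempty (N ≃ₗ[Λ] N') :=
  ⟨(f.quotKerEquivOfSurjective hf).symm ≪≫ₗ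
    Submodule.quotEquivOfEq _ _ (h.coatom_unique (isCoatom_ker hf) (isCoatom_ker hf')) ≪≫ₗ
    f'.quotKerEquivOfSurjective hf'⟩

theorem exists_isProjSystem [IsArtinianRing Λ] (hinj : Injective (ModuleCat.of Λ Λ))
    (huni : ∀ X : ModuleCat.{u} Λ, Module.Finite Λ X → Indec Λ X → IsUniserial Λ X)
    {ι : Type*} (S : ι → ModuleCat.{u} Λ) (hS : ∀ i, IsSimpleModule Λ (S i))
    (hSinj : ∀ i j, Nonempty (S i ≅ S j) → i = j)
    (hSall : ∀ T : ModuleCat.{u} Λ, IsSimpleModule Λ T → ∃ i, Nonempty (T ≅ S i)) :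
    ∃ P : ι → ModuleCat.{u} Λ, IsProjSystem P := by
  choose P hP hPind using fun i => exists_indec_cover hinj (S i)
  have hfin i := (hP i).1
  choose p hp using fun i => (hP i).2.2.2
  have hPuni i := huni (P i) (hfin i) (hPind i)
  have hproj : ∀ i, Module.Projective Λ (P i) := fun i =>
    (IsProjective.iff_projective (P i)).2 (hP i).2.1
  refine ⟨P, hfin, hproj, fun i => ?_, fun i => ?_, hPuni, fun U _ _ K hK => ?_,
    fun U _ _ _ i j f g hf hg => ?_⟩
  · have := (hP i).2.2.1
    exact Module.injective_module_of_injective_object Λ (P i)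
  · by_contra h
    have := not_nontrivial_iff_subsingleton.1 h
    exact (hPind i).1 (ModuleCat.isZero_of_subsingleton (P i))
  · have hsimp : IsSimpleModule Λ (U ⧸ K) := isSimpleModule_iff_isCoatom.2 hK
    obtain ⟨i, ⟨e⟩⟩ := hSall (ModuleCat.of Λ (U ⧸ K)) hsimp
    let e' : (U ⧸ K) ≃ₗ[Λ] S i := e.toLinearEquiv
    obtain ⟨q, hq⟩ := Module.projective_lifting_property K.mkQ (e'.symm.toLinearMap ∘ₗ p i)
      K.mkQ_surjective
    refine ⟨i, q, fun hle => ?_⟩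
    have := IsSimpleModule.nontrivial Λ (S i)
    obtain ⟨x, hx⟩ := exists_ne (0 : S i)
    obtain ⟨y, rfl⟩ := hp i x
    have h0 : K.mkQ (q y) = 0 := (Submodule.Quotient.mk_eq_zero K).2 (hle ⟨y, rfl⟩)
    have := LinearMap.congr_fun hq y
    simp only [LinearMap.comp_apply, h0, LinearEquiv.coe_coe] at this
    exact hx (by simpa using this.symm)
  · have : Module.Finite Λ U := .of_surjective f hf
    obtain ⟨N, hN, -⟩ :=
      (eq_top_or_exists_le_coatom (⊥ : Submodule Λ U)).resolve_left bot_ne_top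
    have hsimp : IsSimpleModule Λ (U ⧸ N) := isSimpleModule_iff_isCoatom.2 hN
    obtain ⟨e⟩ := (hPuni i).nonempty_equiv (hp i) 
      (f' := N.mkQ.comp f) (N.mkQ_surjective.comp hf)
    obtain ⟨e'⟩ := (hPuni j).nonempty_equiv (hp j) 
      (f' := N.mkQ.comp g) (N.mkQ_surjective.comp hg)
    exact hSinj i j ⟨(e ≪≫ₗ e'.symm).toModuleIso⟩

theorem HasCompLength.length_eq {X : ModuleCat.{u} Λ} {t : ℕ} (h : HasCompLength Λ X t)
    (hX : IsFiniteLength Λ X) : Module.length Λ X = t := by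
  obtain ⟨⟨c, hc, hc0, hct⟩, hmax⟩ := h
  apply le_antisymm
  · obtain ⟨q, hq0, hqt⟩ := isFiniteLength_iff_exists_compositionSeries.1 hX
    rw [← Module.length_compositionSeries q hq0 hqt]
    exact_mod_cast hmax q.length ⟨q, q.strictMono, hq0, hqt⟩
  · rw [Module.length_eq_height, ← hct]
    exact Order.length_le_height_last (p := LTSeries.mk t c hc)

theorem IsSelfInjNakayama.exists_isProjSystem {k : Type u} [Field k] [Algebra k Λ]
    [IsArtinianRing Λ] {n m : ℕ} (h : IsSelfInjNakayama k Λ n m) (hm : 1 < m) :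
    ∃ P : Fin n → ModuleCat.{u} Λ, IsProjSystem P ∧ ∀ i, Module.length Λ (P i) = m := by
  obtain ⟨S, hS, hSinj, hSall⟩ := h.simples
  obtain ⟨P, hP⟩ := Rigidity.exists_isProjSystem h.selfinj h.uniserial S hS hSinj hSall
  have hle := hP.length_le_of_radPow_eq_bot h.loewy_top
  obtain ⟨i, hi⟩ := hP.exists_lt_length_of_radPow_ne_bot h.loewy_bot
  refine ⟨P, hP, hP.length_eq_of_connected h.connected hm hle ⟨i, le_antisymm (hle i) ?_⟩⟩
  have := Order.add_one_le_of_lt hi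
  rwa [← Nat.cast_add_one, Nat.sub_add_cancel hm.le] at this

/-- Over `A_{n,m}`, self-extensions of an indecomposable module of length `t ≤ m / 2` are
controlled by residues modulo `n`. -/
theorem IsSelfInjNakayama.subsingleton_ext_self_iff {k : Type u} [Field k] [Algebra k Λ]
    [HasExt.{u} (ModuleCat.{u} Λ)] {n m : ℕ} (h : IsSelfInjNakayama k Λ n m) (hm : 1 < m)
    {t : ℕ} (ht : 0 < t) (htm : 2 * t ≤ m) {X : ModuleCat.{u} Λ} [Module.Finite Λ X]
    (hX : Indec Λ X) (hXt : HasCompLength Λ X t) (j : ℕ) :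
    Subsingleton (Abelian.Ext.{u} X X (j + 1)) ↔ ¬ ∃ c < t, syzygyShift m j t ≡ c [MOD n] := by
  have := h.findim
  have : IsArtinianRing Λ := .of_finite k Λ
  obtain ⟨P, hP, hlen⟩ := h.exists_isProjSystem hm
  obtain ⟨σ, hσ, hcycle⟩ := hP.exists_cycle h.connected
    (fun i => by rw [hlen]; exact_mod_cast hm)
  have : Nontrivial X := by
    by_contra hn
    have := not_nontrivial_iff_subsingleton.1 hn
    exact hX.1 (ModuleCat.isZero_of_subsingleton X)
  obtain ⟨x, f, hf⟩ := hP.exists_cover (h.uniserial X inferInstance hX)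
  have hXlen := hXt.length_eq (isFiniteLength_of_exists_compositionSeries
    (exists_compositionSeries_of_isNoetherian_isArtinian Λ X))
  rw [hP.subsingleton_ext_iff hσ hlen hf hXlen ht htm j 0 t (g := f) hf hXlen (Or.inl rfl)]
  simp only [hcycle, Fintype.card_fin, zero_add, Nat.ModEq.comm]

end SelfInjective

/-- part of Theorem `theo-rigdeg-selfinj-nak`: for `Λ = A_{n,m}` with
`m > n`, Euclidean data `s_i`, weights `k_i = s_{i-1}/s_i` and weighted Fibonacci
numbers `F_l`, if `l < d+1` is odd and `s_{l+1} ≤ t ≤ s_l` with `t ≤ m/2`, then every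
indecomposable module of length `t` has rigidity degree exactly `2F_l`. -/
theorem statement15 (k : Type u) [Field k] (Λ : Type u) [Ring Λ] [Algebra k Λ]
    (n m : ℕ) (hn : 0 < n) (hnm : n < m)
    (hΛ : IsSelfInjNakayama k Λ n m)
    [HasExt.{u} (ModuleCat.{u} Λ)]
    (s : ℕ → ℕ) (F : ℕ → ℕ) (d : ℕ)
    (hs0 : s 0 = n) (hs1 : s 1 = m % n)
    (hrec : ∀ i, i ≤ d → s (i + 2) = s i % s (i + 1))
    (hpos : ∀ i, i ≤ d + 1 → 0 < s i)
    (hzero : s (d + 2) = 0)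
    (hF0 : F 0 = 1) (hF1 : F 1 = s 0 / s 1)
    (hFrec : ∀ j, j + 2 ≤ d + 1 → F (j + 2) = (s (j + 1) / s (j + 2)) * F (j + 1) + F j)
    (l : ℕ) (hlodd : Odd l) (hl : l < d + 1)
    (t : ℕ) (htlo : s (l + 1) ≤ t) (hthi : t ≤ s l) (ht2 : 2 * t ≤ m)
    (X : ModuleCat.{u} Λ) (hXfin : Module.Finite Λ X) (hXind : Indec Λ X)
    (hXlen : HasCompLength Λ X t) :
    rigDeg Λ X = ((2 * F l : ℕ) : ℕ∞) := by
  have ht : 0 < t := (hpos (l + 1) (by omega)).trans_le htlo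
  have htm : t ≤ m := by omega
  obtain ⟨hFl, hself, heven, hodd⟩ :=
    residues_of_odd_convergent hs0 hs1 hrec hpos hF0 hF1 hFrec hlodd hl htlo hthi
  have hext := hΛ.subsingleton_ext_self_iff (by omega) ht ht2 hXind hXlen
  apply le_antisymm
  · refine sSup_le ?_
    rintro _ ⟨r, rfl, -, hr⟩
    rw [Nat.cast_le]
    by_contra! hlt
    have := hr (2 * F l + 1) (by omega) hlt
    rw [hext, syzygyShift_two_mul htm] at this
    exact this hself
  · refine le_sSup ⟨2 * F l, rfl, by omega, fun i hi1 hi2 => ?_⟩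
    obtain ⟨j, rfl⟩ := Nat.exists_eq_add_of_le' hi1
    rw [hext]
    obtain ⟨q, rfl | rfl⟩ := Nat.even_or_odd' j
    · rw [syzygyShift_two_mul htm]
      exact hodd q (by omega)
    · rw [syzygyShift_two_mul_add_one htm]
      exact heven (q + 1) (by omega) (by omega)

end Rigidity
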